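/- Every compact Hausdorff MT-algebra is locally compact. -/

import Mathlib

/-- An MT-algebra: a complete Boolean algebra with an interior operator. -/
structure MTAlg (M : Type*) [CompleteBooleanAlgebra M] where
  box : M → M
  box_top : box ⊤ = ⊤
  box_inf : ∀ a b : M, box (a ⊓ b) = box a ⊓ box b
  box_le : ∀ a : M, box a ≤ a
  box_idem : ∀ a : M, box a ≤ box (box a)

namespace MTAlg

variable {M : Type*} [CompleteBooleanAlgebra M] (T : MTAlg M)

/-- The closure (dual) operator. -/
def dia (a : M) : M := (T.box aᶜ)ᶜ

/-- Open elements. -/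
def IsOpenElem (a : M) : Prop := T.box a = a

/-- Closed elements. -/
def IsClosedElem (a : M) : Prop := T.dia a = a

/-- Saturated elements: meets of open elements. -/
def IsSaturatedElem (a : M) : Prop :=
  ∃ S : Set M, (∀ s ∈ S, T.IsOpenElem s) ∧ a = sInf S

/-- Weakly locally closed elements: meets of a saturated and a closed element. -/
def IsWLC (a : M) : Prop :=
  ∃ s c : M, T.IsSaturatedElem s ∧ T.IsClosedElem c ∧ a = s ⊓ c

/-- T0-algebras: every element is a join of weakly locally closed elements. -/
def IsT0 : Prop :=
  ∀ a : M, ∃ S : Set M, (∀ b ∈ S, T.IsWLC b) ∧ a = sSup S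

/-- T1-algebras: every element is a join of closed elements. -/
def IsT1 : Prop :=
  ∀ a : M, ∃ S : Set M, (∀ b ∈ S, T.IsClosedElem b) ∧ a = sSup S

/-- Join-irreducible elements of the lattice of closed elements. -/
def JoinIrredClosed (p : M) : Prop :=
  T.IsClosedElem p ∧ p ≠ ⊥ ∧
    ∀ a b : M, T.IsClosedElem a → T.IsClosedElem b → p = a ⊔ b → p = a ∨ p = b

/-- Sober MT-algebras. -/
def Sober : Prop :=
  T.IsT0 ∧ ∀ p : M, T.JoinIrredClosed p → ∃ x : M, IsAtom x ∧ p = T.dia x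

/-- Filters of the underlying lattice. -/
def IsFilter (F : Set M) : Prop :=
  ⊤ ∈ F ∧ (∀ a b : M, a ∈ F → a ≤ b → b ∈ F) ∧ (∀ a b : M, a ∈ F → b ∈ F → a ⊓ b ∈ F)

/-- Open filters. -/
def IsOpenFilter (F : Set M) : Prop :=
  IsFilter F ∧ ∀ a ∈ F, T.box a ∈ F

/-- Scott-open filters. -/
def IsScottOpenFilter (F : Set M) : Prop :=
  T.IsOpenFilter F ∧
    ∀ S : Set M, (∀ s ∈ S, T.IsOpenElem s) → S.Nonempty → DirectedOn (· ≤ ·) S →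
      sSup S ∈ F → ∃ s ∈ S, s ∈ F

/-- Compact elements. -/
def IsCompactElem (a : M) : Prop :=
  ∀ S : Set M, (∀ s ∈ S, T.IsOpenElem s) → a ≤ sSup S →
    ∃ t ⊆ S, t.Finite ∧ a ≤ sSup t

/-- The relation `a ◁ b`: there is a compact element between `a` and `b`. -/
def Triangle (a b : M) : Prop := ∃ k : M, T.IsCompactElem k ∧ a ≤ k ∧ k ≤ b

/-- Locally compact MT-algebras. -/
def LocallyCompact : Prop :=
  ∀ u : M, T.IsOpenElem u → u = sSup {v : M | T.IsOpenElem v ∧ T.Triangle v u}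

/-- The way-below relation in the frame of open elements. -/
def WayBelowOpen (a b : M) : Prop :=
  ∀ S : Set M, (∀ s ∈ S, T.IsOpenElem s) → b ≤ sSup S →
    ∃ t ⊆ S, t.Finite ∧ a ≤ sSup t

/-- Elements approximated from above by regular closed elements. -/
def GC (a : M) : Prop :=
  a = sInf {b : M | ∃ c : M, a ≤ T.box c ∧ b = T.dia (T.box c)}

/-- Hausdorff MT-algebras. -/
def IsHausdorff : Prop :=
  ∀ a : M, ∃ S : Set M, (∀ b ∈ S, T.GC b) ∧ a = sSup S

/-- Regular MT-algebras. -/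
def IsRegular : Prop :=
  T.IsT1 ∧ ∀ a : M, T.IsOpenElem a →
    a = sSup {b : M | T.IsOpenElem b ∧ T.dia b ≤ a}

end MTAlg

/-- The atom space of a complete Boolean algebra. -/
abbrev AtomSpace (M : Type*) [CompleteBooleanAlgebra M] : Type _ := {x : M // IsAtom x}

/-- The set of atoms below an element. -/
def eta {M : Type*} [CompleteBooleanAlgebra M] (a : M) : Set (AtomSpace M) :=
  {x : AtomSpace M | x.1 ≤ a}

namespace MTAlg

variable {M : Type*} [CompleteBooleanAlgebra M] (T : MTAlg M)

/-- The topology on the atom space, generated by the images of open elements. -/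
def atTop : TopologicalSpace (AtomSpace M) :=
  TopologicalSpace.generateFrom {U : Set (AtomSpace M) | ∃ u : M, T.IsOpenElem u ∧ U = eta u}

end MTAlg

namespace MTAlg

variable {M : Type*} [CompleteBooleanAlgebra M] (T : MTAlg M)

theorem isOpenElem_box (a : M) : T.IsOpenElem (T.box a) :=
  le_antisymm (T.box_le _) (T.box_idem _)

theorem box_mono {a b : M} (h : a ≤ b) : T.box a ≤ T.box b := by
  rw [← inf_eq_left.mpr h, T.box_inf]
  exact inf_le_right

theorem isOpenElem_top : T.IsOpenElem ⊤ := T.box_top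

variable {T} in
theorem IsOpenElem.inf {a b : M} (ha : T.IsOpenElem a) (hb : T.IsOpenElem b) :
    T.IsOpenElem (a ⊓ b) :=
  (T.box_inf a b).trans (congrArg₂ (· ⊓ ·) ha hb)

theorem compl_dia (a : M) : (T.dia a)ᶜ = T.box aᶜ := compl_compl _

theorem le_dia (a : M) : a ≤ T.dia a :=
  le_compl_comm.mp (T.box_le aᶜ)

variable {T} in
/-- In a compact MT-algebra, an element with open complement is compact. -/
theorem IsCompactElem.of_isOpenElem_compl (hk : T.IsCompactElem ⊤) {a : M}
    (ha : T.IsOpenElem aᶜ) : T.IsCompactElem a := by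
  intro S hS haS
  obtain ⟨t, htS, htf, ht⟩ := hk (insert aᶜ S)
    (by rintro s (rfl | hs); exacts [ha, hS s hs])
    (by
      rw [sSup_insert, ← compl_sup_eq_top]
      exact sup_le_sup_left haS aᶜ)
  refine ⟨t \ {aᶜ}, fun s hs => (htS hs.1).resolve_left hs.2, htf.sdiff, ?_⟩
  have h : (⊤ : M) ≤ aᶜ ⊔ sSup (t \ {aᶜ}) := by
    refine ht.trans (sSup_le fun s hs => ?_)
    by_cases hsa : s = aᶜ
    · exact hsa.le.trans le_sup_left
    · exact (le_sSup (show s ∈ t \ {aᶜ} from ⟨hs, hsa⟩)).trans le_sup_right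
  rwa [sup_comm, ← himp_eq, top_le_iff, himp_eq_top_iff] at h

/-- A finite family of complements of closures of open neighbourhoods of `a` lies below the
complement of the closure of a single open neighbourhood of `a`. -/
theorem exists_isOpenElem_sSup_le {a : M} {t : Set M} (htf : t.Finite)
    (ht : ∀ s ∈ t, ∃ c, a ≤ T.box c ∧ s = (T.dia (T.box c))ᶜ) :
    ∃ v, T.IsOpenElem v ∧ a ≤ v ∧ sSup t ≤ (T.dia v)ᶜ := by
  induction t, htf using Set.Finite.induction_on with
  | empty => exact ⟨⊤, T.isOpenElem_top, le_top, by simp⟩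
  | @insert s t _ _ ih =>
    obtain ⟨v, hv, hav, htv⟩ := ih fun r hr => ht r (Set.mem_insert_of_mem _ hr)
    obtain ⟨c, hac, rfl⟩ := ht s (Set.mem_insert _ _)
    refine ⟨T.box c ⊓ v, (T.isOpenElem_box c).inf hv, le_inf hac hav, ?_⟩
    rw [sSup_insert]
    rw [compl_dia] at htv
    rw [compl_dia, compl_dia]
    exact sup_le (T.box_mono (compl_le_compl inf_le_left))
      (htv.trans (T.box_mono (compl_le_compl inf_le_right)))

variable {T} in
/-- In a compact MT-algebra, an element approximated from above by regular closed elements is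
separated from the complement of any open element above it. -/
theorem GC.exists_isOpenElem_dia_le (hk : T.IsCompactElem ⊤) {a u : M} (ha : T.GC a)
    (hu : T.IsOpenElem u) (hau : a ≤ u) :
    ∃ v, T.IsOpenElem v ∧ a ≤ v ∧ T.dia v ≤ u := by
  have hcompact : T.IsCompactElem uᶜ := hk.of_isOpenElem_compl (by rwa [compl_compl])
  obtain ⟨t, htS, htf, ht⟩ := hcompact {s | ∃ c, a ≤ T.box c ∧ s = (T.dia (T.box c))ᶜ}
    (by
      rintro _ ⟨c, -, rfl⟩
      rw [compl_dia]
      exact T.isOpenElem_box _)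
    (by
      refine compl_le_of_compl_le (le_trans ?_ hau)
      refine le_of_le_of_eq (le_sInf ?_) ha.symm
      rintro _ ⟨c, hc, rfl⟩
      exact compl_le_of_compl_le (le_sSup ⟨c, hc, rfl⟩))
  obtain ⟨v, hv, hav, htv⟩ := T.exists_isOpenElem_sSup_le htf htS
  exact ⟨v, hv, hav, compl_le_compl_iff_le.mp (ht.trans htv)⟩

end MTAlg

/-- Every compact Hausdorff MT-algebra is locally compact. -/
theorem locallyCompact_of_compact_hausdorff {M : Type*} [CompleteBooleanAlgebra M]
    (T : MTAlg M) (hk : T.IsCompactElem ⊤) (hT2 : T.IsHausdorff) :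
    T.LocallyCompact := by
  intro u hu
  apply le_antisymm
  · obtain ⟨S, hS, hSu⟩ := hT2 u
    refine hSu.le.trans (sSup_le fun a ha => ?_)
    obtain ⟨v, hv, hav, hvu⟩ :=
      (hS a ha).exists_isOpenElem_dia_le hk hu ((le_sSup ha).trans hSu.ge)
    refine hav.trans (le_sSup ⟨hv, T.dia v, hk.of_isOpenElem_compl ?_, T.le_dia v, hvu⟩)
    rw [T.compl_dia]
    exact T.isOpenElem_box _
  · refine sSup_le ?_
    rintro v ⟨-, k, -, hvk, hku⟩
    exact hvk.trans hku
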